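/- Let G be a connected d-regular bipartite simple graph on n ≥ 4 vertices with adjacency eigenvalues λ₁ ≥ λ₂ ≥ … ≥ λₙ. Then √( d(n−2d) / ((n−2)(n−3)) ) ≤ λ₂ ≤ √( d(n−3)(n−2d) / (n−2) ). -/

import Mathlib

set_option autoImplicit false

open Matrix Polynomial

section ZeroSum

variable {ι : Type*} {s : Finset ι} {x : ι → ℝ} {a : ι}

theorem nonneg_of_sum_eq_zero_of_le (ha : a ∈ s) (hx : ∑ i ∈ s, x i = 0)
    (hmax : ∀ i ∈ s, x i ≤ x a) : 0 ≤ x a := by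
  by_contra! h
  have : ∑ i ∈ s, x i < 0 :=
    Finset.sum_neg (fun i hi => (hmax i hi).trans_lt h) ⟨a, ha⟩
  linarith

variable [DecidableEq ι]

theorem card_mul_sq_le_of_sum_eq_zero (ha : a ∈ s) (hx : ∑ i ∈ s, x i = 0) :
    (s.card : ℝ) * x a ^ 2 ≤ ((s.card : ℝ) - 1) * ∑ i ∈ s, x i ^ 2 := by
  have hcs := sq_sum_le_card_mul_sum_sq (s := s.erase a) (f := x)
  have hsum := Finset.add_sum_erase s x ha
  have hsq := Finset.add_sum_erase s (fun i => x i ^ 2) ha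
  have hcard : ((s.erase a).card : ℝ) = (s.card : ℝ) - 1 := by
    rw [← Finset.card_erase_add_one ha]
    push_cast
    ring
  rw [hcard, show ∑ i ∈ s.erase a, x i = -x a by linarith] at hcs
  rw [← hsq]
  linarith

theorem sum_sq_le_of_sum_eq_zero_of_le (hx : ∑ i ∈ s, x i = 0)
    (hmax : ∀ i ∈ s, x i ≤ x a) :
    ∑ i ∈ s, x i ^ 2 ≤ (s.card : ℝ) * ((s.card : ℝ) - 1) * x a ^ 2 := by
  have hlow : ∀ i ∈ s, 0 ≤ x i + ((s.card : ℝ) - 1) * x a := by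
    intro i hi
    have h := Finset.sum_le_card_nsmul (s.erase i) x (x a)
      fun j hj => hmax j (Finset.mem_of_mem_erase hj)
    rw [nsmul_eq_mul] at h
    have hcard : ((s.erase i).card : ℝ) = (s.card : ℝ) - 1 := by
      rw [← Finset.card_erase_add_one hi]
      push_cast
      ring
    rw [hcard] at h
    have hsum := Finset.add_sum_erase s x hi
    linarith
  have hprod : 0 ≤ ∑ i ∈ s, (x a - x i) * (x i + ((s.card : ℝ) - 1) * x a) :=
    Finset.sum_nonneg fun i hi => mul_nonneg (sub_nonneg.2 (hmax i hi)) (hlow i hi)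
  have hexpand : ∑ i ∈ s, (x a - x i) * (x i + ((s.card : ℝ) - 1) * x a) =
      (2 - (s.card : ℝ)) * x a * ∑ i ∈ s, x i +
        (s.card : ℝ) * (((s.card : ℝ) - 1) * x a ^ 2) - ∑ i ∈ s, x i ^ 2 := by
    rw [Finset.mul_sum, ← nsmul_eq_mul, ← Finset.sum_const, ← Finset.sum_add_distrib,
      ← Finset.sum_sub_distrib]
    exact Finset.sum_congr rfl fun i _ => by ring
  rw [hexpand, hx] at hprod
  linarith

end ZeroSum

theorem Matrix.IsHermitian.trace_mul_self_eq_sum_eigenvalues_sq {ι : Type*} [Fintype ι]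
    [DecidableEq ι] {A : Matrix ι ι ℝ} (hA : A.IsHermitian) :
    (A * A).trace = ∑ i, hA.eigenvalues i ^ 2 := by
  have h := hA.conjStarAlgAut_star_eigenvectorUnitary
  have h2 := congrArg Matrix.trace (congrArg (fun M => M * M) h)
  simp only [← map_mul] at h2
  rw [Unitary.conjStarAlgAut_star_apply, Matrix.trace_mul_comm, ← mul_assoc,
    Unitary.mul_star_self_of_mem hA.eigenvectorUnitary.2, one_mul] at h2
  rw [h2, Matrix.diagonal_mul_diagonal, Matrix.trace_diagonal]
  simp [sq]

section CharpolyFactorization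

variable {ι : Type*} [Fintype ι] [DecidableEq ι] {A : Matrix ι ι ℝ} {μ : ι → ℝ}

theorem Matrix.IsHermitian.map_eigenvalues_eq_of_charpoly_eq (hA : A.IsHermitian)
    (h : A.charpoly = ∏ i, (X - C (μ i))) :
    Finset.univ.val.map hA.eigenvalues = Finset.univ.val.map μ := by
  have hr := hA.roots_charpoly_eq_eigenvalues
  rw [h, Polynomial.roots_prod _ _ (Finset.prod_ne_zero_iff.2 fun i _ => X_sub_C_ne_zero _)] at hr
  simpa using hr.symm

theorem Matrix.IsHermitian.sum_comp_eigenvalues_eq_of_charpoly_eq (hA : A.IsHermitian)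
    (h : A.charpoly = ∏ i, (X - C (μ i))) (f : ℝ → ℝ) :
    ∑ i, f (hA.eigenvalues i) = ∑ i, f (μ i) := by
  have := congrArg (fun m => (m.map f).sum) (hA.map_eigenvalues_eq_of_charpoly_eq h)
  simpa [Multiset.map_map] using this

theorem Matrix.hasEigenvalue_iff_of_charpoly_eq (h : A.charpoly = ∏ i, (X - C (μ i))) (r : ℝ) :
    Module.End.HasEigenvalue (Matrix.toLin' A) r ↔ ∃ i, μ i = r := by
  rw [Module.End.hasEigenvalue_iff_isRoot_charpoly, Matrix.charpoly_toLin', h,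
    Polynomial.IsRoot.def, Polynomial.eval_prod, Finset.prod_eq_zero_iff]
  simp [sub_eq_zero, eq_comm]

end CharpolyFactorization

namespace SimpleGraph

variable {V : Type*} [Fintype V] {G : SimpleGraph V} [DecidableRel G.Adj] {d : ℕ}

theorem IsRegularOfDegree.trace_adjMatrix_mul_self (hreg : G.IsRegularOfDegree d) :
    (G.adjMatrix ℝ * G.adjMatrix ℝ).trace = Fintype.card V * d := by
  simp only [Matrix.trace, Matrix.diag_apply, adjMatrix_mul_self_apply_self, hreg.degree_eq]
  simp

variable [DecidableEq V]

theorem IsRegularOfDegree.abs_le_of_hasEigenvalue (hreg : G.IsRegularOfDegree d) {r : ℝ}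
    (hr : Module.End.HasEigenvalue (Matrix.toLin' (G.adjMatrix ℝ)) r) : |r| ≤ d := by
  obtain ⟨k, hk⟩ := eigenvalue_mem_ball hr
  rw [mem_closedBall_iff_norm] at hk
  have hrow : ∑ j, ‖G.adjMatrix ℝ k j‖ = d := by
    have := hreg k
    simp [adjMatrix_apply, apply_ite, ← this, ← card_neighborFinset_eq_degree,
      neighborFinset_eq_filter]
  calc |r| = ‖r - G.adjMatrix ℝ k k‖ := by simp
    _ ≤ _ := hk
    _ ≤ ∑ j, ‖G.adjMatrix ℝ k j‖ :=
      Finset.sum_le_sum_of_subset_of_nonneg (Finset.erase_subset _ _) fun _ _ _ => norm_nonneg _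
    _ = d := hrow

theorem IsRegularOfDegree.hasEigenvalue_adjMatrix [Nonempty V] (hreg : G.IsRegularOfDegree d) :
    Module.End.HasEigenvalue (Matrix.toLin' (G.adjMatrix ℝ)) (d : ℝ) := by
  refine Module.End.hasEigenvalue_of_hasEigenvector (x := Function.const V 1)
    ⟨Module.End.mem_eigenspace_iff.2 ?_, by simp⟩
  ext v
  rw [Matrix.toLin'_apply, adjMatrix_mulVec_const_apply_of_regular hreg]
  simp

theorem IsRegularOfDegree.hasEigenvalue_adjMatrix_neg [Nonempty V] (hreg : G.IsRegularOfDegree d)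
    (hbip : G.Colorable 2) :
    Module.End.HasEigenvalue (Matrix.toLin' (G.adjMatrix ℝ)) (-d : ℝ) := by
  obtain ⟨c⟩ := hbip
  let x : V → ℝ := fun v => if c v = 0 then 1 else -1
  have hx : ∀ v w, G.Adj v w → x w = -x v := by
    intro v w h
    have hc : c v ≠ c w := c.valid h
    by_cases hv : c v = 0
    · have hw : c w ≠ 0 := fun hw => hc (hv.trans hw.symm)
      simp [x, hv, hw]
    · have hw : c w = 0 := by lia
      simp [x, hv, hw]
  obtain ⟨v₀⟩ := ‹Nonempty V›
  refine Module.End.hasEigenvalue_of_hasEigenvector (x := x)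
    ⟨Module.End.mem_eigenspace_iff.2 ?_, fun h => ?_⟩
  · ext v
    rw [Matrix.toLin'_apply, adjMatrix_mulVec_apply,
      Finset.sum_congr rfl fun w hw => hx v w ((mem_neighborFinset _ _ _).1 hw), Finset.sum_const,
      card_neighborFinset_eq_degree, hreg v]
    simp
  · have := congrFun h v₀
    by_cases hv : c v₀ = 0 <;> simp [x, hv] at this

end SimpleGraph

/-- Bounds for the second largest adjacency eigenvalue of a connected
`d`-regular bipartite graph on `n ≥ 4` vertices. Bipartiteness is expressed as
2-colorability. The adjacency eigenvalues, in decreasing order with multiplicity, are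
encoded by the antitone function `μ` through the factorization of the characteristic
polynomial. -/
theorem stmt_7 {n d : ℕ} (hn : 4 ≤ n) (G : SimpleGraph (Fin n)) [DecidableRel G.Adj]
    (hconn : G.Connected) (hreg : G.IsRegularOfDegree d) (hbip : G.Colorable 2)
    (μ : Fin n → ℝ) (hanti : Antitone μ)
    (hchar : (G.adjMatrix ℝ).charpoly = ∏ i, (Polynomial.X - Polynomial.C (μ i))) :
    Real.sqrt ((d : ℝ) * ((n : ℝ) - 2 * d) / (((n : ℝ) - 2) * ((n : ℝ) - 3)))
        ≤ μ ⟨1, by omega⟩ ∧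
      μ ⟨1, by omega⟩ ≤
        Real.sqrt ((d : ℝ) * ((n : ℝ) - 3) * ((n : ℝ) - 2 * d) / ((n : ℝ) - 2)) := by
  have hA := G.isHermitian_adjMatrix ℝ
  have : Nonempty (Fin n) := ⟨⟨0, by omega⟩⟩
  have hn' : (4 : ℝ) ≤ n := by exact_mod_cast hn
  have hbound (i : Fin n) : |μ i| ≤ d :=
    hreg.abs_le_of_hasEigenvalue ((hasEigenvalue_iff_of_charpoly_eq hchar _).2 ⟨i, rfl⟩)
  obtain ⟨p, hp⟩ := (hasEigenvalue_iff_of_charpoly_eq hchar _).1 hreg.hasEigenvalue_adjMatrix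
  obtain ⟨q, hq⟩ :=
    (hasEigenvalue_iff_of_charpoly_eq hchar _).1 (hreg.hasEigenvalue_adjMatrix_neg hbip)
  set a : Fin n := ⟨0, by omega⟩ with ha
  set b : Fin n := ⟨1, by omega⟩ with hb
  set z : Fin n := ⟨n - 1, by omega⟩ with hz
  have hμa : μ a = d :=
    le_antisymm (abs_le.1 (hbound a)).2 (hp ▸ hanti (Fin.le_def.2 (Nat.zero_le _)))
  have hμz : μ z = -d :=
    le_antisymm (hq ▸ hanti (Fin.le_def.2 (by simp only [hz]; omega))) (abs_le.1 (hbound z)).1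
  have hsum : ∑ i, μ i = 0 := by
    have h := hA.sum_comp_eigenvalues_eq_of_charpoly_eq hchar id
    have ht := hA.trace_eq_sum_eigenvalues
    rw [G.trace_adjMatrix ℝ] at ht
    simpa using h.symm.trans ht.symm
  have hsq : ∑ i, μ i ^ 2 = n * d := by
    rw [← hA.sum_comp_eigenvalues_eq_of_charpoly_eq hchar (· ^ 2),
      ← hA.trace_mul_self_eq_sum_eigenvalues_sq, hreg.trace_adjMatrix_mul_self, Fintype.card_fin]
  have hza : z ∈ Finset.univ.erase a := by
    simp only [Finset.mem_erase, Finset.mem_univ, and_true, ne_eq, Fin.ext_iff, ha, hz]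
    omega
  set s := (Finset.univ.erase a).erase z with hs
  have hbs : b ∈ s := by
    simp only [hs, Finset.mem_erase, Finset.mem_univ, and_true, ne_eq, Fin.ext_iff, ha, hb, hz]
    omega
  have hcard : (s.card : ℝ) = n - 2 := by
    rw [hs, Finset.card_erase_of_mem hza, Finset.card_erase_of_mem (Finset.mem_univ _),
      Finset.card_univ, Fintype.card_fin, Nat.sub_sub, Nat.cast_sub (by omega)]
    norm_num
  have hsplit (f : Fin n → ℝ) : f a + (f z + ∑ i ∈ s, f i) = ∑ i, f i := by
    rw [Finset.add_sum_erase _ f hza, Finset.add_sum_erase _ f (Finset.mem_univ a)]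
  have hsum' : ∑ i ∈ s, μ i = 0 := by
    have := hsplit μ
    linarith
  have hsq' : ∑ i ∈ s, μ i ^ 2 = d * (n - 2 * d) := by
    have := hsplit fun i => μ i ^ 2
    simp only [hμa, hμz, hsq] at this
    linarith
  have hmax : ∀ i ∈ s, μ i ≤ μ b := by
    intro i hi
    simp only [hs, Finset.mem_erase, ne_eq, Fin.ext_iff, ha] at hi
    exact hanti (Fin.le_def.2 (by simp only [hb]; omega))
  have hlower := sum_sq_le_of_sum_eq_zero_of_le hsum' hmax
  have hupper := card_mul_sq_le_of_sum_eq_zero hbs hsum'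
  rw [hcard, hsq'] at hlower hupper
  constructor
  · refine Real.sqrt_le_iff.2 ⟨nonneg_of_sum_eq_zero_of_le hbs hsum' hmax, ?_⟩
    rw [div_le_iff₀ (mul_pos (by linarith) (by linarith))]
    linarith
  · refine Real.le_sqrt_of_sq_le ?_
    rw [le_div_iff₀ (by linarith)]
    linarith
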